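/- Let E be a finite-dimensional complex inner product space. Let G_1, …, G_p and K_1, …, K_q be skew-adjoint endomorphisms of E satisfying the Clifford relations G_μ G_ν + G_ν G_μ = −2 δ_{μν} Id_E for all 1 ≤ μ, ν ≤ p and K_b K_c + K_c K_b = −2 δ_{bc} Id_E for all 1 ≤ b, c ≤ q, and suppose that G_μ K_b = K_b G_μ for all μ and b. Let A be a q × q real symmetric positive semidefinite matrix and let B be a q × p real matrix with Bᵀ B ≤ I_p in the Loewner order. Then the endomorphism T = Σ_{b=1}^{q} Σ_{μ=1}^{p} (A B)_{bμ} G_μ K_b of E is self-adjoint and satisfies T ≤ (tr A) · Id_E, i.e. (tr A) · Id_E − T is positive semidefinite. (This is the algebraic core of Lemma 2.9, with G_μ = γⁿγ^μ, K_b = γ̂^m γ̂^b, A the second fundamental form of ∂M and B the matrix of the distance-nonincreasing map ∂f.) -/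

import Mathlib

open Matrix
open scoped ComplexOrder

local notation "⟪" x ", " y "⟫" => @inner ℂ _ _ x y

open scoped MatrixOrder in
/-- A real symmetric matrix with nonnegative quadratic form is of the form `Sᵀ S`. -/
lemma exists_eq_transpose_mul_self {n : Type*} [Fintype n] {A : Matrix n n ℝ} (hA : A.IsSymm)
    (hA' : ∀ v : n → ℝ, 0 ≤ v ⬝ᵥ A *ᵥ v) : ∃ S : Matrix n n ℝ, A = Sᵀ * S := by
  classical
  have hpos : A.PosSemidef := .of_dotProduct_mulVec_nonneg
    ((conjTranspose_eq_transpose_of_trivial A).trans hA) (by simpa using hA')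
  obtain ⟨S, hS⟩ := CStarAlgebra.nonneg_iff_eq_star_mul_self.1 hpos.nonneg
  exact ⟨S, by rwa [star_eq_conjTranspose, conjTranspose_eq_transpose_of_trivial] at hS⟩

/-- A linear combination of operators satisfying the Clifford relations squares to minus the
squared length of its coefficient vector. -/
lemma sum_smul_mul_self_of_clifford {R ι : Type*} [Ring R] [Algebra ℂ R] [Fintype ι]
    [DecidableEq ι] (J : ι → R)
    (hJ : ∀ i j, J i * J j + J j * J i = if i = j then (-2 : ℂ) • (1 : R) else 0)
    (u : ι → ℝ) :
    (∑ i, (u i : ℂ) • J i) * (∑ i, (u i : ℂ) • J i) = (-((u ⬝ᵥ u : ℝ) : ℂ)) • (1 : R) := by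
  have hexp : (∑ i, (u i : ℂ) • J i) * (∑ i, (u i : ℂ) • J i) =
      ∑ i, ∑ j, ((u i : ℂ) * u j) • (J i * J j) := by
    simp only [Finset.sum_mul_sum, smul_mul_smul_comm]
  have hexp' : (∑ i, (u i : ℂ) • J i) * (∑ i, (u i : ℂ) • J i) =
      ∑ i, ∑ j, ((u i : ℂ) * u j) • (J j * J i) := by
    rw [hexp, Finset.sum_comm]
    simp only [mul_comm]
  have htwo : (2 : ℂ) • ((∑ i, (u i : ℂ) • J i) * (∑ i, (u i : ℂ) • J i)) =
      (2 : ℂ) • ((-((u ⬝ᵥ u : ℝ) : ℂ)) • (1 : R)) := by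
    rw [two_smul]
    nth_rewrite 1 [hexp]
    rw [hexp']
    simp only [← Finset.sum_add_distrib, ← smul_add, hJ, smul_ite, smul_zero,
      Finset.sum_ite_eq, Finset.mem_univ, if_true, smul_smul, ← Finset.sum_smul]
    congr 1
    simp only [dotProduct, Complex.ofReal_sum, Complex.ofReal_mul, mul_neg, Finset.mul_sum,
      ← Finset.sum_neg_distrib]
    exact Finset.sum_congr rfl fun _ _ => by ring
  exact smul_right_injective R (two_ne_zero (α := ℂ)) htwo

/-- If `Bᵀ B ≤ 1`, then `Bᵀ` does not increase the Euclidean length. -/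
lemma vecMul_dotProduct_self_le {m n : Type*} [Fintype m] [Fintype n] [DecidableEq n]
    (B : Matrix m n ℝ) (hB : ∀ v : n → ℝ, 0 ≤ v ⬝ᵥ ((1 : Matrix n n ℝ) - Bᵀ * B) *ᵥ v)
    (s : m → ℝ) : (s ᵥ* B) ⬝ᵥ (s ᵥ* B) ≤ s ⬝ᵥ s := by
  have hcontr := hB (s ᵥ* B)
  rw [sub_mulVec, one_mulVec, dotProduct_sub, ← mulVec_mulVec, dotProduct_mulVec (s ᵥ* B) Bᵀ,
    vecMul_transpose] at hcontr
  have hsq : 0 ≤ (s - B *ᵥ (s ᵥ* B)) ⬝ᵥ (s - B *ᵥ (s ᵥ* B)) :=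
    Finset.sum_nonneg fun _ _ => mul_self_nonneg _
  rw [sub_dotProduct, dotProduct_sub, dotProduct_sub,
    dotProduct_comm (B *ᵥ (s ᵥ* B)) s, dotProduct_mulVec s] at hsq
  linarith

/-- A real linear combination of skew-adjoint operators is skew-adjoint. -/
lemma adjoint_sum_smul_of_skew {E ι : Type*} [NormedAddCommGroup E] [InnerProductSpace ℂ E]
    [FiniteDimensional ℂ E] [Fintype ι] (J : ι → (E →ₗ[ℂ] E))
    (hJ : ∀ i, ∀ x y : E, ⟪J i x, y⟫ = -⟪x, J i y⟫) (u : ι → ℝ) :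
    LinearMap.adjoint (∑ i, (u i : ℂ) • J i) = -∑ i, (u i : ℂ) • J i := by
  have hadj (i : ι) : LinearMap.adjoint (J i) = -J i := by
    refine ((LinearMap.eq_adjoint_iff _ _).2 fun x y => ?_).symm
    rw [LinearMap.neg_apply, inner_neg_left, hJ, neg_neg]
  simp only [map_sum, map_smulₛₗ, Complex.conj_ofReal, hadj, smul_neg, Finset.sum_neg_distrib]

/-- If `L` and `M` are commuting skew-adjoint operators with `L² = -a` and `M² = -b`, where
`a ≤ b`, then `L M ≤ b`. -/
lemma isPositive_smul_one_sub_mul_of_skew {E : Type*} [NormedAddCommGroup E]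
    [InnerProductSpace ℂ E] [FiniteDimensional ℂ E] {L M : E →ₗ[ℂ] E} {a b : ℝ}
    (hL : LinearMap.adjoint L = -L) (hM : LinearMap.adjoint M = -M) (hLM : L * M = M * L)
    (hLL : L * L = (-(a : ℂ)) • (1 : E →ₗ[ℂ] E)) (hMM : M * M = (-(b : ℂ)) • (1 : E →ₗ[ℂ] E))
    (hab : a ≤ b) : ((b : ℂ) • (1 : E →ₗ[ℂ] E) - L * M).IsPositive := by
  have hsq : (LinearMap.adjoint (L + M) * (L + M)).IsPositive :=
    LinearMap.isPositive_adjoint_comp_self _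
  have hdecomp : (b : ℂ) • (1 : E →ₗ[ℂ] E) - L * M =
      (1 / 2 : ℂ) • (LinearMap.adjoint (L + M) * (L + M)) +
        (((b - a) / 2 : ℝ) : ℂ) • (1 : E →ₗ[ℂ] E) := by
    rw [map_add, hL, hM, ← neg_add, neg_mul, add_mul, mul_add, mul_add, hLL, hMM, ← hLM]
    push_cast
    module
  rw [hdecomp]
  refine (hsq.smul_of_nonneg (one_div_nonneg.2 zero_le_two)).add
    (LinearMap.isPositive_one.smul_of_nonneg ?_)
  exact Complex.zero_le_real.2 (by linarith)

/-- The algebraic core of Lemma 2.9: given commuting Clifford families `G` and `K`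
of skew-adjoint operators, a positive semidefinite symmetric matrix `A` and a matrix `B`
with `Bᵀ B ≤ I`, the operator `T = ∑ (A B)_{bμ} G_μ K_b` is self-adjoint and
`T ≤ (tr A) · Id`. -/
theorem stmt0 {E : Type*} [NormedAddCommGroup E] [InnerProductSpace ℂ E]
    [FiniteDimensional ℂ E] {p q : ℕ}
    (G : Fin p → (E →ₗ[ℂ] E)) (K : Fin q → (E →ₗ[ℂ] E))
    (hGskew : ∀ μ, ∀ x y : E, ⟪G μ x, y⟫ = -⟪x, G μ y⟫)
    (hKskew : ∀ b, ∀ x y : E, ⟪K b x, y⟫ = -⟪x, K b y⟫)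
    (hGcl : ∀ μ ν, G μ * G ν + G ν * G μ =
      if μ = ν then (-2 : ℂ) • (1 : E →ₗ[ℂ] E) else 0)
    (hKcl : ∀ b c, K b * K c + K c * K b =
      if b = c then (-2 : ℂ) • (1 : E →ₗ[ℂ] E) else 0)
    (hGK : ∀ μ b, G μ * K b = K b * G μ)
    (A : Matrix (Fin q) (Fin q) ℝ) (hAsymm : A.IsSymm)
    (hApsd : ∀ v : Fin q → ℝ, 0 ≤ v ⬝ᵥ A *ᵥ v)
    (B : Matrix (Fin q) (Fin p) ℝ)
    (hB : ∀ v : Fin p → ℝ, 0 ≤ v ⬝ᵥ ((1 : Matrix (Fin p) (Fin p) ℝ) - Bᵀ * B) *ᵥ v) :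
    (∀ x y : E, ⟪(∑ b, ∑ μ, ((A * B) b μ : ℂ) • (G μ * K b)) x, y⟫ =
      ⟪x, (∑ b, ∑ μ, ((A * B) b μ : ℂ) • (G μ * K b)) y⟫) ∧
    (∀ x : E, 0 ≤ ⟪x, ((A.trace : ℂ) • (1 : E →ₗ[ℂ] E) -
      ∑ b, ∑ μ, ((A * B) b μ : ℂ) • (G μ * K b)) x⟫) := by
  obtain ⟨S, rfl⟩ := exists_eq_transpose_mul_self hAsymm hApsd
  have hT : ∑ b, ∑ μ, (((Sᵀ * S) * B) b μ : ℂ) • (G μ * K b) =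
      ∑ c, (∑ μ, ((S c ᵥ* B) μ : ℂ) • G μ) * (∑ b, (S c b : ℂ) • K b) := by
    simp only [Finset.sum_mul_sum, smul_mul_smul_comm]
    rw [Finset.sum_comm, Finset.sum_comm (s := (Finset.univ : Finset (Fin q)))
      (t := (Finset.univ : Finset (Fin p)))]
    refine Finset.sum_congr rfl fun μ _ => ?_
    rw [Finset.sum_comm]
    refine Finset.sum_congr rfl fun b _ => ?_
    rw [← Finset.sum_smul, Matrix.mul_assoc, mul_apply]
    simp [mul_apply, vecMul, dotProduct, mul_comm]
  have htr : (((Sᵀ * S).trace : ℝ) : ℂ) • (1 : E →ₗ[ℂ] E) =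
      ∑ c, ((S c ⬝ᵥ S c : ℝ) : ℂ) • (1 : E →ₗ[ℂ] E) := by
    rw [← Finset.sum_smul, trace_mul_comm, ← Complex.ofReal_sum]
    rfl
  have hpos : ((((Sᵀ * S).trace : ℝ) : ℂ) • (1 : E →ₗ[ℂ] E) -
      ∑ b, ∑ μ, (((Sᵀ * S) * B) b μ : ℂ) • (G μ * K b)).IsPositive := by
    rw [hT, htr, ← Finset.sum_sub_distrib]
    refine LinearMap.isPositive_sum _ fun c _ => ?_
    refine isPositive_smul_one_sub_mul_of_skew (adjoint_sum_smul_of_skew G hGskew _)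
      (adjoint_sum_smul_of_skew K hKskew _) ?_ (sum_smul_mul_self_of_clifford G hGcl _)
      (sum_smul_mul_self_of_clifford K hKcl _) (vecMul_dotProduct_self_le B hB _)
    exact Commute.sum_left _ _ _ fun μ _ => Commute.sum_right _ _ _ fun b _ =>
      ((show Commute (G μ) (K b) from hGK μ b).smul_left _).smul_right _
  refine ⟨fun x y => ?_, fun x => hpos.inner_nonneg_right x⟩
  have hsymm := hpos.isSymmetric x y
  simpa only [LinearMap.sub_apply, inner_sub_left, inner_sub_right, LinearMap.smul_apply,
    Module.End.one_apply, inner_smul_left, inner_smul_right, Complex.conj_ofReal,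
    sub_right_inj] using hsymm
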